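/- Let q₁, q₂ ≥ 0 with q₁ + q₂ = 1. Then lim_{τ→∞} Λ(τ)·(q₁, q₂)ᵀ = ( k·q₁ + (1−r)·q₂ , (1−k)·q₁ + r·q₂ )ᵀ; hence whenever k + r > 1 the asymptotic (stationary) distribution of the Funessian process depends explicitly on the initial distribution, breaking the uniqueness of the stationary state. -/

import Mathlib

open Filter Matrix

/-- Transition matrix of the Funessian process, acting on probability column
vectors. -/
noncomputable def Lam (k r α τ : ℝ) : Matrix (Fin 2) (Fin 2) ℝ :=
  !![k + (1 - k) * Real.exp (-α * τ), (1 - r) * (1 - Real.exp (-α * τ));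
     (1 - k) * (1 - Real.exp (-α * τ)), r + (1 - r) * Real.exp (-α * τ)]

/-- The asymptotic (stationary) distribution of the Funessian process is
`(k·q₁ + (1−r)·q₂, (1−k)·q₁ + r·q₂)ᵀ`, which depends explicitly on the initial
distribution `(q₁, q₂)ᵀ` whenever `k + r > 1`. -/
theorem stationary_distribution_depends_on_initial (k r α : ℝ)
    (hk0 : 0 ≤ k) (hk1 : k ≤ 1) (hr0 : 0 ≤ r) (hr1 : r ≤ 1) (hα : 0 < α)
    (q₁ q₂ : ℝ) (hq1 : 0 ≤ q₁) (hq2 : 0 ≤ q₂) (hq : q₁ + q₂ = 1) :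
    Tendsto (fun τ => (Lam k r α τ) *ᵥ ![q₁, q₂]) atTop
      (nhds ![k * q₁ + (1 - r) * q₂, (1 - k) * q₁ + r * q₂]) := by
  have hexp : Tendsto (fun τ : ℝ => Real.exp (-α * τ)) atTop (nhds 0) :=
    Real.tendsto_exp_atBot.comp (tendsto_id.const_mul_atTop_of_neg (neg_neg_of_pos hα))
  have hcont : Continuous fun x : ℝ =>
      ![(k + (1 - k) * x) * q₁ + (1 - r) * (1 - x) * q₂,
        (1 - k) * (1 - x) * q₁ + (r + (1 - r) * x) * q₂] := by
    fun_prop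
  convert (hcont.tendsto 0).comp hexp using 1
  · ext τ i
    fin_cases i <;> simp [Lam, Matrix.mulVec, dotProduct, Fin.sum_univ_two]
  · simp
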